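/- arXiv:1803.10038 — 2 statements merged into one kernel-verified Lean document; each statement's English description precedes it below -/
import Mathlib

section
/- Let X be a complex Hilbert space and let A be a densely defined self-adjoint operator in X. Then every weak solution y : ℝ → X of the equation y'(t) = A y(t), t ∈ ℝ, is infinitely strongly differentiable on ℝ, i.e., y has strong (norm-topology) derivatives of every order at every point of ℝ. -/
open scoped InnerProductSpace
open Filter Topology

section WS
variable {X : Type*} [NormedAddCommGroup X] [InnerProductSpace ℂ X] [CompleteSpace X]

structure WSol (A : X →ₗ.[ℂ] X) (y : ℝ → X) : Prop where
  cont : Continuous y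
  weak : ∀ g : A.domain, ∀ t : ℝ,
      HasDerivAt (fun s : ℝ => ⟪(g : X), y s⟫_ℂ) ⟪(A g : X), y t⟫_ℂ t

variable {A : X →ₗ.[ℂ] X}

lemma WSol.sub {y z : ℝ → X} (hy : WSol A y) (hz : WSol A z) : WSol A (fun t => y t - z t) := by
  refine ⟨hy.cont.sub hz.cont, fun g t => ?_⟩
  simp only [inner_sub_right]
  exact (hy.weak g t).sub (hz.weak g t)

lemma WSol.shift {y : ℝ → X} (hy : WSol A y) (h : ℝ) : WSol A (fun t => y (t + h)) := by
  refine ⟨hy.cont.comp (by fun_prop), fun g t => ?_⟩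
  exact (hy.weak g (t + h)).comp_add_const t h

lemma hasDerivAt_inner_const {u : ℝ → X} {v : X} {t : ℝ} (g : X) (hu : HasDerivAt u v t) :
    HasDerivAt (fun s => ⟪g, u s⟫_ℂ) ⟪g, v⟫_ℂ t := by
  have := (hasDerivAt_const t g).inner ℂ hu
  simpa using this

lemma WSol.inner_deriv {u : ℝ → X} (hu : WSol A u) {v : X} {t : ℝ} (hd : HasDerivAt u v t)
    (g : A.domain) : ⟪(g : X), v⟫_ℂ = ⟪A g, u t⟫_ℂ :=
  (hasDerivAt_inner_const (g : X) hd).unique (hu.weak g t)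

lemma WSol.exists_dom (hdense : Dense (A.domain : Set X)) (hsa : A.adjoint = A)
    {u : ℝ → X} (hu : WSol A u) {v : X} {t : ℝ} (hd : HasDerivAt u v t) :
    ∃ x : A.domain, (x : X) = u t ∧ A x = v := by
  have key : ∀ x : A.domain, ⟪v, (x : X)⟫_ℂ = ⟪u t, A x⟫_ℂ := fun x => by
    rw [← inner_conj_symm, hu.inner_deriv hd x, inner_conj_symm]
  have h1 : ∃ x : A.adjoint.domain, (x : X) = u t ∧ A.adjoint x = v :=
    ⟨⟨u t, A.mem_adjoint_domain_of_exists _ ⟨v, key⟩⟩, rfl,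
      LinearPMap.adjoint_apply_eq hdense _ key⟩
  rwa [hsa] at h1

lemma WSol.inner_strong (hdense : Dense (A.domain : Set X)) (hsa : A.adjoint = A)
    {u v : ℝ → X} (hu : WSol A u) (hd : ∀ t, HasDerivAt u (v t) t) (t s : ℝ) :
    ⟪u (t - s), u (t + s)⟫_ℂ = ⟪u t, u t⟫_ℂ := by
  have h : ∀ s, HasDerivAt (fun s => ⟪u (t - s), u (t + s)⟫_ℂ) 0 s := by
    intro s
    have h1 : HasDerivAt (fun s => u (t - s)) (-v (t - s)) s := (hd (t - s)).comp_const_sub t s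
    have h2 : HasDerivAt (fun s => u (t + s)) (v (t + s)) s := (hd (t + s)).comp_const_add t s
    have h3 := h1.inner ℂ h2
    obtain ⟨x, hx, hAx⟩ := hu.exists_dom hdense hsa (hd (t - s))
    have h4 := hu.inner_deriv (hd (t + s)) x
    rw [hx, hAx] at h4
    rw [h4, inner_neg_left, add_neg_cancel] at h3
    exact h3
  have := is_const_of_deriv_eq_zero (fun s => (h s).differentiableAt) (fun s => (h s).deriv) s 0
  simpa using this

/-- Steklov average -/
noncomputable def stek (y : ℝ → X) (e : ℝ) (t : ℝ) : X :=
  e⁻¹ • ((∫ r in (0:ℝ)..(t + e), y r) - ∫ r in (0:ℝ)..t, y r)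

lemma hasDerivAt_prim {y : ℝ → X} (hy : Continuous y) (t : ℝ) :
    HasDerivAt (fun t => ∫ r in (0:ℝ)..t, y r) (y t) t :=
  hy.integral_hasStrictDerivAt 0 t |>.hasDerivAt

lemma stek_deriv {y : ℝ → X} (hy : Continuous y) (e t : ℝ) :
    HasDerivAt (stek y e) (e⁻¹ • (y (t + e) - y t)) t :=
  (((hasDerivAt_prim hy (t + e)).comp_add_const t e).sub (hasDerivAt_prim hy t)).const_smul e⁻¹

lemma stek_tendsto {y : ℝ → X} (hy : Continuous y) (t : ℝ) :
    Tendsto (fun e => stek y e t) (𝓝[≠] 0) (𝓝 (y t)) :=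
  hasDerivAt_iff_tendsto_slope_zero.1 (hasDerivAt_prim hy t)

lemma WSol.stek {y : ℝ → X} (hy : WSol A y) (e : ℝ) : WSol A (stek y e) := by
  refine ⟨continuous_iff_continuousAt.2 fun t => (stek_deriv hy.cont e t).continuousAt,
    fun g t => ?_⟩
  have h1 := hasDerivAt_inner_const (g : X) (stek_deriv hy.cont e t)
  have h : ∀ s, HasDerivAt (fun s => ⟪A g, ∫ r in (0:ℝ)..s, y r⟫_ℂ - ⟪(g : X), y s⟫_ℂ) 0 s := by
    intro s
    have h0 := (hasDerivAt_inner_const (A g) (hasDerivAt_prim hy.cont s)).sub (hy.weak g s)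
    rw [sub_self] at h0
    exact h0
  have h2 := is_const_of_deriv_eq_zero (fun s => (h s).differentiableAt)
    (fun s => (h s).deriv) (t + e) t
  convert h1 using 1
  simp only [_root_.stek, inner_smul_right_eq_smul, inner_sub_right]
  congr 1
  linear_combination h2

lemma WSol.inner_eq (hdense : Dense (A.domain : Set X)) (hsa : A.adjoint = A)
    {y : ℝ → X} (hy : WSol A y) (t s : ℝ) :
    ⟪y (t - s), y (t + s)⟫_ℂ = ⟪y t, y t⟫_ℂ := by
  have h1 := (stek_tendsto hy.cont (t - s)).inner (𝕜 := ℂ) (stek_tendsto hy.cont (t + s))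
  have h2 := (stek_tendsto hy.cont t).inner (𝕜 := ℂ) (stek_tendsto hy.cont t)
  refine tendsto_nhds_unique h1 (h2.congr fun e => ?_)
  exact ((hy.stek e).inner_strong hdense hsa (stek_deriv hy.cont e) t s).symm

lemma WSol.diff_sq (hdense : Dense (A.domain : Set X)) (hsa : A.adjoint = A)
    {y : ℝ → X} (hy : WSol A y) (t s : ℝ) :
    ‖y (t + s) - y (t - s)‖ ^ 2 = ‖y (t + s)‖ ^ 2 + ‖y (t - s)‖ ^ 2 - 2 * ‖y t‖ ^ 2 := by
  have h := hy.inner_eq hdense hsa t s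
  rw [norm_sub_rev, norm_sub_sq (𝕜 := ℂ), h, inner_self_eq_norm_sq]
  ring

lemma WSol.mid (hdense : Dense (A.domain : Set X)) (hsa : A.adjoint = A)
    {y : ℝ → X} (hy : WSol A y) (t s : ℝ) :
    2 * ‖y t‖ ^ 2 ≤ ‖y (t + s)‖ ^ 2 + ‖y (t - s)‖ ^ 2 := by
  have := hy.diff_sq hdense hsa t s
  nlinarith [sq_nonneg ‖y (t + s) - y (t - s)‖]

lemma WSol.discrete (hdense : Dense (A.domain : Set X)) (hsa : A.adjoint = A)
    {y : ℝ → X} (hy : WSol A y) (t h : ℝ) (n : ℕ) :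
    (n : ℝ) ^ 2 * ‖y (t + h) - y (t - h)‖ ^ 2 ≤
      ‖y (t + n * h)‖ ^ 2 + ‖y (t - n * h)‖ ^ 2 - 2 * ‖y t‖ ^ 2 := by
  set D := ‖y (t + h) - y (t - h)‖ ^ 2 with hD
  set a : ℕ → ℝ := fun n => ‖y (t + n * h)‖ ^ 2 + ‖y (t - n * h)‖ ^ 2 - 2 * ‖y t‖ ^ 2 with ha
  have a0 : a 0 = 0 := by simp [ha]; ring
  have a1 : a 1 = D := by
    rw [hD, hy.diff_sq hdense hsa t h]; simp [ha]
  have step : ∀ n, a (n + 1) - a n + 2 * D ≤ a (n + 2) - a (n + 1) := by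
    intro n
    have hw : WSol A (fun r => y (r + h) - y (r + -h)) := (hy.shift h).sub (hy.shift (-h))
    have m := hw.mid hdense hsa t ((n + 1) * h)
    simp only [← sub_eq_add_neg] at m
    rw [hy.diff_sq hdense hsa (t + (n + 1) * h) h, hy.diff_sq hdense hsa (t - (n + 1) * h) h] at m
    simp only [ha]
    push_cast
    rw [show t + ((n:ℝ) + 1) * h + h = t + (n + 2) * h by ring,
      show t + ((n:ℝ) + 1) * h - h = t + n * h by ring,
      show t - ((n:ℝ) + 1) * h + h = t - n * h by ring,
      show t - ((n:ℝ) + 1) * h - h = t - (n + 2) * h by ring] at m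
    linarith
  have key : ∀ n : ℕ, (n : ℝ) ^ 2 * D ≤ a n ∧ (2 * n + 1) * D ≤ a (n + 1) - a n := by
    intro n
    induction n with
    | zero => simp [a0, a1]
    | succ n ih =>
      have := step n
      push_cast
      constructor <;> linarith [ih.1, ih.2]
  exact (key n).1

lemma WSol.deriv_bound (hdense : Dense (A.domain : Set X)) (hsa : A.adjoint = A)
    {y : ℝ → X} (hy : WSol A y) {v : X} {t : ℝ} (hd : HasDerivAt y v t) :
    ‖v‖ ^ 2 ≤ ‖y (t + 1)‖ ^ 2 + ‖y (t - 1)‖ ^ 2 := by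
  have h1 : HasDerivAt (fun s => y (t + s)) v 0 := by
    apply HasDerivAt.comp_const_add; simpa using hd
  have h2 : HasDerivAt (fun s => y (t - s)) (-v) 0 := by
    apply HasDerivAt.comp_const_sub; simpa using hd
  have h3 := hasDerivAt_iff_tendsto_slope_zero.1 (h1.sub h2)
  have h4 : Tendsto (fun n : ℕ => 1 / ((n : ℝ) + 1)) atTop (𝓝[≠] 0) :=
    tendsto_nhdsWithin_iff.2 ⟨tendsto_one_div_add_atTop_nhds_zero_nat,
      Eventually.of_forall fun n => by simp; positivity⟩
  have h5 := ((h3.comp h4).norm.pow 2)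
  have h6 : ‖v - -v‖ ^ 2 ≤ ‖y (t + 1)‖ ^ 2 + ‖y (t - 1)‖ ^ 2 := by
    refine le_of_tendsto' h5 fun n => ?_
    have h7 := hy.discrete hdense hsa t (1 / ((n : ℝ) + 1)) (n + 1)
    have h8 : ((n + 1 : ℕ) : ℝ) * (1 / ((n : ℝ) + 1)) = 1 := by push_cast; field_simp
    rw [h8] at h7
    simp only [Function.comp, Pi.sub_apply, zero_add, sub_zero, add_zero, sub_self, norm_smul, mul_pow]
    have h9 : ‖(1 / ((n : ℝ) + 1))⁻¹‖ = ((n + 1 : ℕ) : ℝ) := by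
      rw [one_div, inv_inv, Real.norm_of_nonneg (by positivity)]; push_cast; rfl
    rw [h9]
    nlinarith [sq_nonneg ‖y t‖]
  rw [sub_neg_eq_add, ← two_smul ℝ v, norm_smul, mul_pow] at h6
  norm_num at h6
  nlinarith [sq_nonneg ‖v‖]

lemma WSol.differentiableAt (hdense : Dense (A.domain : Set X)) (hsa : A.adjoint = A)
    {y : ℝ → X} (hy : WSol A y) (t : ℝ) : DifferentiableAt ℝ y t := by
  have hc : Cauchy (Filter.map (fun e : ℝ => e⁻¹ • (y (t + e) - y t)) (𝓝[≠] 0)) := by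
    rw [cauchy_map_iff]
    refine ⟨inferInstance, ?_⟩
    rw [Metric.uniformity_eq_comap_nhds_zero, tendsto_comap_iff]
    have lim : ∀ r : ℝ, Tendsto (fun p : ℝ × ℝ => ‖_root_.stek y p.1 r - _root_.stek y p.2 r‖ ^ 2)
        (𝓝[≠] 0 ×ˢ 𝓝[≠] 0) (𝓝 0) := by
      intro r
      have := ((((stek_tendsto hy.cont r).comp tendsto_fst).sub
        ((stek_tendsto hy.cont r).comp tendsto_snd)).norm.pow 2 :
        Tendsto _ ((𝓝[≠] (0:ℝ)) ×ˢ (𝓝[≠] (0:ℝ))) _)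
      simpa using this
    have l2 := (lim (t + 1)).add (lim (t - 1))
    rw [add_zero] at l2
    have l3 := (squeeze_zero (fun p => sq_nonneg _) (fun p : ℝ × ℝ =>
      ((hy.stek p.1).sub (hy.stek p.2)).deriv_bound hdense hsa
        ((stek_deriv hy.cont p.1 t).sub (stek_deriv hy.cont p.2 t))) l2).sqrt
    simp only [Real.sqrt_zero, Real.sqrt_sq (norm_nonneg _)] at l3
    refine l3.congr fun p => ?_
    simp [dist_eq_norm]
  obtain ⟨v, hv⟩ := CompleteSpace.complete hc
  exact (hasDerivAt_iff_tendsto_slope_zero.2 hv).differentiableAt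

lemma WSol.deriv (hdense : Dense (A.domain : Set X)) (hsa : A.adjoint = A)
    {y : ℝ → X} (hy : WSol A y) : WSol A (deriv y) := by
  have hd := fun t => (hy.differentiableAt hdense hsa t).hasDerivAt
  constructor
  · refine continuous_iff_continuousAt.2 fun t => ?_
    have lim : ∀ r : ℝ, Tendsto (fun s : ℝ => ‖y (r + (s - t)) - y r‖ ^ 2) (𝓝 t) (𝓝 0) := by
      intro r
      have hc := hy.cont
      have : Continuous (fun s : ℝ => ‖y (r + (s - t)) - y r‖ ^ 2) := by fun_prop
      simpa using this.tendsto t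
    have l2 := (lim (t + 1)).add (lim (t - 1))
    rw [add_zero] at l2
    have l3 := (squeeze_zero (fun p => sq_nonneg _) (fun s : ℝ =>
      ((hy.shift (s - t)).sub hy).deriv_bound hdense hsa
        (((hd (t + (s - t))).comp_add_const t (s - t)).sub (hd t))) l2).sqrt
    simp only [Real.sqrt_zero, Real.sqrt_sq (norm_nonneg _), add_sub_cancel] at l3
    exact tendsto_iff_norm_sub_tendsto_zero.2 l3
  · intro g t
    have h1 : (fun s => ⟪(g : X), _root_.deriv y s⟫_ℂ) = fun s => ⟪A g, y s⟫_ℂ :=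
      funext fun s => hy.inner_deriv (hd s) g
    rw [h1]
    exact hasDerivAt_inner_const (A g) (hd t)

end WS

/-- every weak solution of `y' = A y` on `ℝ`, with `A` a densely defined
self-adjoint operator in a complex Hilbert space, is strongly infinitely differentiable,
i.e. has strong derivatives of every order at every point of `ℝ`. -/
theorem weakSolution_infinitely_differentiable_of_selfAdjoint
    {X : Type*} [NormedAddCommGroup X] [InnerProductSpace ℂ X] [CompleteSpace X]
    (A : X →ₗ.[ℂ] X) (hdense : Dense (A.domain : Set X)) (hsa : A.adjoint = A)
    (y : ℝ → X) (hcont : Continuous y)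
    (hweak : ∀ g : A.domain, ∀ t : ℝ,
      HasDerivAt (fun s : ℝ => ⟪(g : X), y s⟫_ℂ) ⟪(A g : X), y t⟫_ℂ t) :
    ∀ (n : ℕ) (t : ℝ), DifferentiableAt ℝ (iteratedDeriv n y) t := by
  have h : ∀ n : ℕ, WSol A (iteratedDeriv n y) := by
    intro n
    induction n with
    | zero => rw [iteratedDeriv_zero]; exact ⟨hcont, hweak⟩
    | succ n ih => rw [iteratedDeriv_succ]; exact ih.deriv hdense hsa
  exact fun n t => (h n).differentiableAt hdense hsa t
end

section
/- Let X be a complex Banach space, M > 0, (Pₖ)_{k≥1} a sequence of bounded linear operators on X with ‖Pₖ‖ ≤ M and Pᵢ Pⱼ = 0 whenever i ≠ j, and (eₖ)_{k≥1} a sequence of vectors with ‖eₖ‖ = 1 and Pₖ eₖ = eₖ for all k. Then there exists a continuous linear functional h* on X with ‖h*‖ ≤ Σ_{k=1}^∞ k^{−2} such that for every k ≥ 1 the value ⟨eₖ, h*⟩ is a nonnegative real number satisfying ⟨eₖ, h*⟩ ≥ M^{−1} k^{−2}. -/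
/-- given bounded operators `(Pₖ)_{k≥1}` with `‖Pₖ‖ ≤ M`, `Pᵢ Pⱼ = 0` for
`i ≠ j`, and unit vectors `(eₖ)_{k≥1}` with `Pₖ eₖ = eₖ`, there is a continuous linear
functional `h*` with `‖h*‖ ≤ Σₖ k⁻²` such that each `⟨eₖ, h*⟩` is a nonnegative real
number with `⟨eₖ, h*⟩ ≥ M⁻¹ k⁻²`.  (Sequences are indexed by `k : ℕ` standing for the
index `k + 1 ≥ 1`.) -/
theorem exists_functional_of_disjoint_projections
    {X : Type*} [NormedAddCommGroup X] [NormedSpace ℂ X] [CompleteSpace X]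
    (M : ℝ) (hM : 0 < M) (P : ℕ → X →L[ℂ] X) (e : ℕ → X)
    (hP : ∀ k, ‖P k‖ ≤ M) (hPP : ∀ i j, i ≠ j → (P i).comp (P j) = 0)
    (he : ∀ k, ‖e k‖ = 1) (hPe : ∀ k, P k (e k) = e k) :
    ∃ h : X →L[ℂ] ℂ, ‖h‖ ≤ (∑' k : ℕ, (((k : ℝ) + 1) ^ 2)⁻¹) ∧
      ∀ k : ℕ, ∃ r : ℝ, 0 ≤ r ∧ h (e k) = (r : ℂ) ∧
        M⁻¹ * (((k : ℝ) + 1) ^ 2)⁻¹ ≤ r := by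
  have hs : Summable (fun k : ℕ => (((k : ℝ) + 1) ^ 2)⁻¹) := by
    have h := (summable_nat_add_iff 1).mpr (Real.summable_nat_pow_inv.mpr (by norm_num : 1 < 2))
    simpa using h
  have hf : ∀ k, ∃ f : X →L[ℂ] ℂ, ‖f‖ = 1 ∧ f (e k) = 1 := by
    intro k
    have hne : e k ≠ 0 := by
      intro h0
      have := he k
      simp [h0] at this
    obtain ⟨f, h1, h2⟩ := exists_dual_vector ℂ (e k) (norm_ne_zero_iff.mpr hne)
    exact ⟨f, h1, by simp [h2, he k]⟩
  choose f hf1 hf2 using hf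
  let g : ℕ → X →L[ℂ] ℂ := fun k =>
    ((M⁻¹ * (((k : ℝ) + 1) ^ 2)⁻¹ : ℝ) : ℂ) • (f k).comp (P k)
  have hg : ∀ k, ‖g k‖ ≤ (((k : ℝ) + 1) ^ 2)⁻¹ := by
    intro k
    have h1 : ‖(f k).comp (P k)‖ ≤ M := by
      refine (ContinuousLinearMap.opNorm_comp_le _ _).trans ?_
      rw [hf1, one_mul]
      exact hP k
    have h0 : 0 ≤ M⁻¹ * (((k : ℝ) + 1) ^ 2)⁻¹ := by positivity
    calc ‖g k‖ = (M⁻¹ * (((k : ℝ) + 1) ^ 2)⁻¹) * ‖(f k).comp (P k)‖ := by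
          rw [norm_smul, Complex.norm_real, Real.norm_of_nonneg h0]
      _ ≤ (M⁻¹ * (((k : ℝ) + 1) ^ 2)⁻¹) * M := by gcongr
      _ = (((k : ℝ) + 1) ^ 2)⁻¹ := by field_simp
  have hgs : Summable g := Summable.of_norm_bounded hs hg
  refine ⟨∑' k, g k, tsum_of_norm_bounded hs.hasSum hg, fun k => ?_⟩
  refine ⟨M⁻¹ * (((k : ℝ) + 1) ^ 2)⁻¹, by positivity, ?_, le_rfl⟩
  have hap : (∑' i, g i) (e k) = ∑' i, g i (e k) :=
    (ContinuousLinearMap.apply ℂ ℂ (e k)).map_tsum hgs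
  rw [hap, tsum_eq_single k]
  · simp only [g, ContinuousLinearMap.smul_apply, ContinuousLinearMap.comp_apply, hPe, hf2,
      smul_eq_mul, mul_one]
  · intro i hi
    have h0 : P i (e k) = 0 := by
      have := DFunLike.congr_fun (hPP i k hi) (e k)
      simpa [hPe] using this
    simp [g, h0]
end
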